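/- Let p be a prime and G a finite group. Let A_p(G) be the poset of nontrivial elementary abelian p-subgroups of G ordered by inclusion, and let K_p(G) be the poset of nonempty sets of pairwise commuting subgroups of order p of G, ordered by inclusion of sets. Then the geometric realizations of the nerves of A_p(G) and K_p(G) (each poset regarded as a category) are homotopy equivalent topological spaces. -/

import Mathlib

open CategoryTheory

/-- The Quillen poset `A_p(G)` of nontrivial elementary abelian `p`-subgroups of `G`,
ordered by inclusion. -/
def QuillenPoset (p : ℕ) (G : Type) [Group G] : Type :=
  {Q : Subgroup G // Q ≠ ⊥ ∧ (∀ x ∈ Q, ∀ y ∈ Q, Commute x y) ∧ ∀ x ∈ Q, x ^ p = 1}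

instance (p : ℕ) (G : Type) [Group G] : PartialOrder (QuillenPoset p G) :=
  Subtype.partialOrder _

/-- The commuting poset `K_p(G)` of nonempty sets of pairwise commuting subgroups of order
`p` of `G`, ordered by inclusion of sets. -/
def CommutingPoset (p : ℕ) (G : Type) [Group G] : Type :=
  {κ : Set (Subgroup G) // κ.Nonempty ∧ (∀ R ∈ κ, Nat.card R = p) ∧
    κ.Pairwise fun R R' => ∀ r ∈ R, ∀ r' ∈ R', Commute r r'}

instance (p : ℕ) (G : Type) [Group G] : PartialOrder (CommutingPoset p G) :=
  Subtype.partialOrder _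

namespace FunOnFinite

variable {I J : Type*} [Fintype I] [Fintype J]

lemma exists_ne_zero_of_linearMap_ne_zero {f : I → J} {a : I → ℝ} {q : J}
    (h : linearMap ℝ ℝ f a q ≠ 0) : ∃ x, a x ≠ 0 ∧ f x = q := by
  classical
  rw [FunOnFinite.linearMap_apply_apply] at h
  obtain ⟨i, hi, hi'⟩ := Finset.exists_ne_zero_of_sum_ne_zero h
  exact ⟨i, hi', by simpa using hi⟩

lemma linearMap_nonneg {f : I → J} {a : I → ℝ} (h : ∀ x, 0 ≤ a x) (q : J) :
    0 ≤ linearMap ℝ ℝ f a q := by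
  classical
  rw [FunOnFinite.linearMap_apply_apply]
  exact Finset.sum_nonneg fun x _ ↦ h x

lemma sum_linearMap (f : I → J) (a : I → ℝ) :
    ∑ q, linearMap ℝ ℝ f a q = ∑ x, a x := by
  classical
  simp only [FunOnFinite.linearMap_apply_apply]
  exact Finset.sum_fiberwise Finset.univ f a

end FunOnFinite

namespace stdSimplex

variable {I J : Type*} [Fintype I] [Fintype J]

lemma map_congr {f g : I → J}
    {t : stdSimplex ℝ I} (h : ∀ i, t i ≠ 0 → f i = g i) :
    map f t = map g t := by
  classical
  ext y
  simp only [map_coe, FunOnFinite.linearMap_apply_apply, Finset.sum_filter]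
  refine Finset.sum_congr rfl fun i _ ↦ ?_
  by_cases hi : t i = 0
  · simp [hi]
  · rw [h i hi]

lemma map_injective [Nonempty I] {f : I → J}
    (hf : Function.Injective f) :
    Function.Injective (map (S := ℝ) f) := by
  refine Function.LeftInverse.injective (g := map (Function.invFun f)) fun t ↦ ?_
  rw [map_comp_apply, Function.invFun_comp hf, map_id_apply]

lemma exists_ne_zero_of_map_ne_zero {f : I → J} {t : stdSimplex ℝ I} {x : J}
    (hx : map f t x ≠ 0) : ∃ i, t i ≠ 0 ∧ f i = x :=
  FunOnFinite.exists_ne_zero_of_linearMap_ne_zero hx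

lemma exists_map_eq [Nonempty I] {e : I → J} {μ : stdSimplex ℝ J}
    (h : ∀ x, μ x ≠ 0 → x ∈ Set.range e) : ∃ t, map e t = μ := by
  refine ⟨map (Function.invFun e) μ, ?_⟩
  rw [map_comp_apply]
  conv_rhs => rw [← map_id_apply μ]
  exact map_congr fun x hx ↦ Function.invFun_eq (h x hx)

lemma support_nonempty (μ : stdSimplex ℝ I) : {x | μ x ≠ 0}.Nonempty := by
  by_contra h
  rw [Set.not_nonempty_iff_eq_empty, Set.eq_empty_iff_forall_notMem] at h
  have := sum_eq_one μ
  simp_all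

lemma continuous_apply (x : I) : Continuous (fun μ : stdSimplex ℝ I ↦ μ x) :=
  (_root_.continuous_apply x).comp continuous_subtype_val

end stdSimplex

open Simplicial Opposite

namespace GeomRealization

/-- The characteristic map of a simplex of `X` in the geometric realization of `X`. -/
noncomputable def realizationSimplex (X : SSet.{0}) {n : SimplexCategory} (x : X.obj (op n)) :
    C(stdSimplex ℝ (Fin (n.len + 1)), SSet.toTop.obj X) :=
  TopCat.toSSetObjEquiv _ _ ((sSetTopAdj.unit.app X).app _ x)

lemma realizationSimplex_map (X : SSet.{0}) {n m : SimplexCategory} (f : n ⟶ m)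
    (x : X.obj (op m)) (t : stdSimplex ℝ (Fin (n.len + 1))) :
    realizationSimplex X (X.map f.op x) t = realizationSimplex X x (stdSimplex.map f t) := by
  have h := ConcreteCategory.congr_hom ((sSetTopAdj.unit.app X).naturality f.op) x
  have h' := congrArg (fun y ↦ TopCat.toSSetObjEquiv _ _ y t) h
  exact h'

lemma toSSetObjEquiv_homEquiv (X : SSet.{0}) {Z : TopCat.{0}} (φ : SSet.toTop.obj X ⟶ Z)
    {n : SimplexCategory} (x : X.obj (op n)) (t : stdSimplex ℝ (Fin (n.len + 1))) :
    TopCat.toSSetObjEquiv _ _ ((sSetTopAdj.homEquiv X Z φ).app _ x) t =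
      φ (realizationSimplex X x t) := by
  rw [Adjunction.homEquiv_unit]
  rfl

lemma realization_hom_ext (X : SSet.{0}) {Z : TopCat.{0}} {φ ψ : SSet.toTop.obj X ⟶ Z}
    (h : ∀ (n : SimplexCategory) (x : X.obj (op n)) (t : stdSimplex ℝ (Fin (n.len + 1))),
      φ (realizationSimplex X x t) = ψ (realizationSimplex X x t)) : φ = ψ := by
  apply (sSetTopAdj.homEquiv X Z).injective
  ext n x
  apply (TopCat.toSSetObjEquiv _ _).injective
  ext t
  have := h n.unop x t
  rw [← toSSetObjEquiv_homEquiv, ← toSSetObjEquiv_homEquiv] at this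
  exact this

lemma homEquiv_symm_realizationSimplex (X : SSet.{0}) {Z : TopCat.{0}}
    (φ : X ⟶ TopCat.toSSet.obj Z)
    {n : SimplexCategory} (x : X.obj (op n)) (t : stdSimplex ℝ (Fin (n.len + 1))) :
    (sSetTopAdj.homEquiv X Z).symm φ (realizationSimplex X x t) =
      TopCat.toSSetObjEquiv _ _ (φ.app _ x) t := by
  rw [← toSSetObjEquiv_homEquiv, Equiv.apply_symm_apply]

end GeomRealization

/-- The order complex of a finite poset `P`, in barycentric coordinates: the probability weights
on `P` whose support is a chain. -/
def ChainSimplex (P : Type) [PartialOrder P] [Fintype P] : Type :=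
  {μ : stdSimplex ℝ P // IsChain (· ≤ ·) {x | μ x ≠ 0}}

namespace ChainSimplex

variable {P Q : Type} [PartialOrder P] [Fintype P] [PartialOrder Q] [Fintype Q]

instance : TopologicalSpace (ChainSimplex P) := inferInstanceAs (TopologicalSpace (Subtype _))

lemma isChain_support_map {I : Type*} [Fintype I] [Preorder I] (f : I →o P) {t : stdSimplex ℝ I}
    (ht : IsChain (· ≤ ·) {i | t i ≠ 0}) :
    IsChain (· ≤ ·) {x | stdSimplex.map f t x ≠ 0} := by
  intro x hx y hy _
  obtain ⟨i, hi, rfl⟩ := stdSimplex.exists_ne_zero_of_map_ne_zero hx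
  obtain ⟨j, hj, rfl⟩ := stdSimplex.exists_ne_zero_of_map_ne_zero hy
  exact (ht.total hi hj).imp (fun h ↦ f.monotone h) (fun h ↦ f.monotone h)

instance : T2Space (ChainSimplex P) := inferInstanceAs (T2Space (Subtype _))

/-- The simplex of the order complex spanned by the values of an order-preserving map. -/
noncomputable def ofOrderHom {n : ℕ} (c : Fin (n + 1) →o P) :
    C(stdSimplex ℝ (Fin (n + 1)), ChainSimplex P) where
  toFun t := ⟨stdSimplex.map c t, isChain_support_map c (fun i _ j _ _ ↦ le_total i j)⟩
  continuous_toFun := (stdSimplex.continuous_map _).subtype_mk _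

open GeomRealization

/-- The order-preserving map underlying a simplex of the nerve of a poset. -/
def nerveOrderHom {n : SimplexCategory} (c : (nerve P).obj (op n)) : Fin (n.len + 1) →o P where
  toFun := Prefunctor.obj (Functor.toPrefunctor c)
  monotone' := Functor.monotone c

omit [Fintype P] in
lemma nerveOrderHom_map {n m : SimplexCategory} (f : n ⟶ m) (c : (nerve P).obj (op m)) :
    (nerveOrderHom ((nerve P).map f.op c) : Fin (n.len + 1) → P) = nerveOrderHom c ∘ f :=
  rfl

lemma ofOrderHom_nerve_map {n m : SimplexCategory} (f : n ⟶ m) (c : (nerve P).obj (op m))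
    (t : stdSimplex ℝ (Fin (n.len + 1))) :
    ofOrderHom (nerveOrderHom ((nerve P).map f.op c)) t =
      ofOrderHom (nerveOrderHom c) (stdSimplex.map f t) :=
  Subtype.ext ((congrArg (fun g ↦ stdSimplex.map g t) (nerveOrderHom_map f c)).trans
    (stdSimplex.map_comp_apply f (nerveOrderHom c) t).symm)

/-- The canonical map from the geometric realization of the nerve to the order complex. -/
noncomputable def fromRealization :
    SSet.toTop.obj (nerve P) ⟶ TopCat.of (ChainSimplex P) :=
  (sSetTopAdj.homEquiv _ _).symm
    { app n := ↾fun x ↦ (TopCat.toSSetObjEquiv (TopCat.of (ChainSimplex P)) _).symm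
        (ofOrderHom (nerveOrderHom x))
      naturality n m f := by
        ext x
        apply (TopCat.toSSetObjEquiv (TopCat.of (ChainSimplex P)) _).injective
        refine ContinuousMap.ext fun t ↦ ?_
        exact ofOrderHom_nerve_map _ _ _ }

lemma fromRealization_realizationSimplex {n : SimplexCategory} (c : (nerve P).obj (op n))
    (t : stdSimplex ℝ (Fin (n.len + 1))) :
    fromRealization (realizationSimplex (nerve P) c t) = ofOrderHom (nerveOrderHom c) t := by
  rw [fromRealization, homEquiv_symm_realizationSimplex]
  rfl

omit [Fintype P] in
lemma exists_enumeration [Finite P] {s : Set P} (hs : IsChain (· ≤ ·) s) (hne : s.Nonempty) :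
    ∃ (n : ℕ) (e : Fin (n + 1) ↪o P), Set.range e = s := by
  classical
  let _ := hs.linearOrder
  let _ := Fintype.ofFinite s
  have : Nonempty s := hne.to_subtype
  obtain ⟨n, hn⟩ := Nat.exists_eq_succ_of_ne_zero (Fintype.card_ne_zero (α := s))
  refine ⟨n, (Fintype.orderIsoFinOfCardEq s hn).toOrderEmbedding.trans
    (OrderEmbedding.subtype (· ∈ s)), ?_⟩
  ext x
  constructor
  · rintro ⟨i, rfl⟩
    exact (Fintype.orderIsoFinOfCardEq s hn i).2
  · intro hx
    exact ⟨(Fintype.orderIsoFinOfCardEq s hn).symm ⟨x, hx⟩, by simp⟩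

/-- The simplex of the nerve of a poset given by an order-preserving map. -/
def nerveSimplex {n : SimplexCategory} (c : Fin (n.len + 1) →o P) : (nerve P).obj (op n) :=
  c.monotone.functor

/-- The simplex of the realization of the nerve given by an order-preserving map. -/
noncomputable def nervePoint {n : ℕ} (c : Fin (n + 1) →o P) :
    C(stdSimplex ℝ (Fin (n + 1)), SSet.toTop.obj (nerve P)) :=
  realizationSimplex (nerve P) (n := .mk n) (nerveSimplex (n := .mk n) c)

omit [Fintype P] in
lemma nervePoint_comp {n m : ℕ} (θ : Fin (n + 1) →o Fin (m + 1))
    (c : Fin (m + 1) →o P) (t : stdSimplex ℝ (Fin (n + 1))) :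
    nervePoint (c.comp θ) t = nervePoint c (stdSimplex.map θ t) := by
  have h := realizationSimplex_map (nerve P) (n := .mk n) (m := .mk m) (SimplexCategory.mkHom θ)
    (nerveSimplex (n := .mk m) c) t
  have h' : ((SimplexCategory.mkHom θ : SimplexCategory.mk n ⟶ .mk m) : Fin (n + 1) → Fin (m + 1))
    = θ := rfl
  exact h.trans (congrArg (fun f ↦ realizationSimplex (nerve P) (n := .mk m)
    (nerveSimplex (n := .mk m) c) (stdSimplex.map f t)) h')

lemma nervePoint_eq_of_range_subset {n m : ℕ} {c : Fin (n + 1) →o P} {d : Fin (m + 1) →o P}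
    {t : stdSimplex ℝ (Fin (n + 1))} {u : stdSimplex ℝ (Fin (m + 1))}
    (hcd : Set.range c ⊆ Set.range d) (h : stdSimplex.map c t = stdSimplex.map d u) :
    nervePoint c t = nervePoint d u := by
  have hd : IsChain (· ≤ ·) (Set.range d) := by
    rintro _ ⟨i, rfl⟩ _ ⟨j, rfl⟩ _
    exact (le_total i j).imp (fun h ↦ d.monotone h) (fun h ↦ d.monotone h)
  obtain ⟨k, e, he⟩ := exists_enumeration hd (Set.range_nonempty d)
  have key : ∀ {l : ℕ} (b : Fin (l + 1) →o P), Set.range b ⊆ Set.range d →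
      ∃ θ : Fin (l + 1) →o Fin (k + 1), b = e.toOrderHom.comp θ := by
    intro l b hb
    have : ∀ i, ∃ j, e j = b i := fun i ↦ by
      have := hb ⟨i, rfl⟩
      rwa [← he] at this
    choose θ hθ using this
    refine ⟨⟨θ, fun i j hij ↦ ?_⟩, ?_⟩
    · rw [← e.le_iff_le, hθ, hθ]
      exact b.monotone hij
    · ext i
      exact (hθ i).symm
  obtain ⟨θ, rfl⟩ := key c hcd
  obtain ⟨η, rfl⟩ := key d subset_rfl
  rw [nervePoint_comp, nervePoint_comp]
  congr 1
  apply stdSimplex.map_injective e.injective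
  rw [stdSimplex.map_comp_apply, stdSimplex.map_comp_apply]
  exact h

lemma exists_enumeration_map_eq (μ : ChainSimplex P) :
    ∃ (n : ℕ) (e : Fin (n + 1) ↪o P) (t : stdSimplex ℝ (Fin (n + 1))),
      Set.range e = {x | μ.1 x ≠ 0} ∧ stdSimplex.map e t = μ.1 := by
  obtain ⟨n, e, he⟩ := exists_enumeration μ.2 (stdSimplex.support_nonempty _)
  obtain ⟨t, ht⟩ := stdSimplex.exists_map_eq (e := e) (μ := μ.1) fun x hx ↦ by rwa [he]
  exact ⟨n, e, t, he, ht⟩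

/-- The point of the realization of the nerve with given barycentric coordinates. -/
noncomputable def toRealization (μ : ChainSimplex P) : SSet.toTop.obj (nerve P) :=
  nervePoint (exists_enumeration_map_eq μ).choose_spec.choose.toOrderHom
    (exists_enumeration_map_eq μ).choose_spec.choose_spec.choose

lemma toRealization_eq {n : ℕ} (c : Fin (n + 1) →o P) (t : stdSimplex ℝ (Fin (n + 1)))
    (μ : ChainSimplex P) (h : stdSimplex.map c t = μ.1) :
    toRealization μ = nervePoint c t := by
  obtain ⟨h₁, h₂⟩ := (exists_enumeration_map_eq μ).choose_spec.choose_spec.choose_spec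
  refine nervePoint_eq_of_range_subset ?_ (h₂.trans h.symm)
  refine h₁.subset.trans fun x hx ↦ ?_
  rw [Set.mem_ofPred_eq, ← h] at hx
  obtain ⟨i, -, hi⟩ := stdSimplex.exists_ne_zero_of_map_ne_zero hx
  exact ⟨i, hi⟩

lemma exists_ofOrderHom_eq {n : ℕ} {c : Fin (n + 1) →o P} {μ : ChainSimplex P}
    (h : {x | μ.1 x ≠ 0} ⊆ Set.range c) : ∃ t, ofOrderHom c t = μ := by
  obtain ⟨t, ht⟩ := stdSimplex.exists_map_eq (e := c) (μ := μ.1) fun x hx ↦ h hx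
  exact ⟨t, Subtype.ext ht⟩

/-- Continuity can be checked on a finite family of simplices covering the order complex. -/
lemma continuous_of_family {ι : Type*} [Finite ι] {n : ι → ℕ} (c : ∀ i, Fin (n i + 1) →o P)
    (hc : ∀ μ : ChainSimplex P, ∃ i, {x | μ.1 x ≠ 0} ⊆ Set.range (c i))
    {Z : Type*} [TopologicalSpace Z] {f : ChainSimplex P → Z}
    (hf : ∀ i, Continuous (fun t ↦ f (ofOrderHom (c i) t))) :
    Continuous f := by
  have hg : Continuous (fun a : (Σ i, stdSimplex ℝ (Fin (n i + 1))) ↦ ofOrderHom (c a.1) a.2) :=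
    continuous_sigma fun i ↦ (ofOrderHom (c i)).continuous
  refine (Topology.IsQuotientMap.of_surjective_continuous (fun μ ↦ ?_) hg).continuous_iff.mpr
    (continuous_sigma fun i ↦ hf i)
  obtain ⟨i, hi⟩ := hc μ
  obtain ⟨t, ht⟩ := exists_ofOrderHom_eq hi
  exact ⟨⟨i, t⟩, ht⟩

lemma continuous_of_comp_ofOrderHom {Z : Type*} [TopologicalSpace Z] {f : ChainSimplex P → Z}
    (hf : ∀ (n : ℕ) (c : Fin (n + 1) →o P), Continuous (fun t ↦ f (ofOrderHom c t))) :
    Continuous f := by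
  choose n e he using fun s : {s : Set P // IsChain (· ≤ ·) s ∧ s.Nonempty} ↦
    exists_enumeration s.2.1 s.2.2
  exact continuous_of_family (fun s ↦ (e s).toOrderHom)
    (fun μ ↦ ⟨⟨_, μ.2, stdSimplex.support_nonempty μ.1⟩,
      (he ⟨_, μ.2, stdSimplex.support_nonempty μ.1⟩).superset⟩) fun s ↦ hf _ _

lemma toRealization_ofOrderHom {n : ℕ} (c : Fin (n + 1) →o P) (t : stdSimplex ℝ (Fin (n + 1))) :
    toRealization (ofOrderHom c t) = nervePoint c t :=
  toRealization_eq _ _ _ rfl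

lemma continuous_toRealization : Continuous (toRealization (P := P)) :=
  continuous_of_comp_ofOrderHom fun n c ↦ by
    simp_rw [toRealization_ofOrderHom]
    exact (nervePoint c).continuous

/-- The geometric realization of the nerve of a finite poset is its order complex. -/
noncomputable def realizationHomeomorph : SSet.toTop.obj (nerve P) ≃ₜ ChainSimplex P where
  toFun := fromRealization
  invFun := toRealization
  left_inv := by
    have : fromRealization (P := P) ≫ TopCat.ofHom ⟨toRealization, continuous_toRealization⟩ =
        𝟙 _ := by
      refine realization_hom_ext _ fun n x t ↦ ?_
      have h := fromRealization_realizationSimplex x t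
      have h' := congrArg toRealization h
      exact h'.trans (toRealization_eq (nerveOrderHom x) t _ rfl)
    exact fun x ↦ ConcreteCategory.congr_hom this x
  right_inv μ := by
    obtain ⟨n, e, t, -, h⟩ := exists_enumeration_map_eq μ
    rw [toRealization_eq e.toOrderHom t μ h]
    exact (fromRealization_realizationSimplex _ _).trans (Subtype.ext h)
  continuous_toFun := fromRealization.hom.continuous
  continuous_invFun := continuous_toRealization

/-- The total weight of the elements strictly below `x`. -/
noncomputable def massBelow (μ : ChainSimplex P) (x : P) : ℝ :=
  open scoped Classical in ∑ y with y < x, μ.1 y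

lemma continuous_apply_coe (x : P) : Continuous (fun μ : ChainSimplex P ↦ μ.1 x) :=
  (stdSimplex.continuous_apply x).comp continuous_subtype_val

lemma continuous_massBelow (x : P) : Continuous (fun μ : ChainSimplex P ↦ massBelow μ x) :=
  continuous_finsetSum _ fun y _ ↦ continuous_apply_coe y

lemma massBelow_nonneg (μ : ChainSimplex P) (x : P) : 0 ≤ massBelow μ x :=
  Finset.sum_nonneg fun y _ ↦ stdSimplex.zero_le _ y

lemma massBelow_add_le_massBelow (μ : ChainSimplex P) {x y : P} (h : x < y) :
    massBelow μ x + μ.1 x ≤ massBelow μ y := by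
  classical
  unfold massBelow
  rw [add_comm, ← Finset.sum_insert (by simp)]
  refine Finset.sum_le_sum_of_subset_of_nonneg (fun z hz ↦ ?_) fun z _ _ ↦ stdSimplex.zero_le _ z
  simp only [Finset.mem_insert, Finset.mem_filter, Finset.mem_univ, true_and] at hz ⊢
  rcases hz with rfl | hz
  · exact h
  · exact hz.trans h

lemma massBelow_add_le_one (μ : ChainSimplex P) (x : P) : massBelow μ x + μ.1 x ≤ 1 := by
  classical
  unfold massBelow
  rw [add_comm, ← Finset.sum_insert (by simp), ← stdSimplex.sum_eq_one μ.1]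
  exact Finset.sum_le_sum_of_subset_of_nonneg (Finset.subset_univ _)
    fun z _ _ ↦ stdSimplex.zero_le _ z

/-- The part of the weight of `x` which lies below height `s` when the weights of the elements of
the support are stacked in increasing order. -/
noncomputable def lowerPart (s : ℝ) (μ : ChainSimplex P) (x : P) : ℝ :=
  min (massBelow μ x + μ.1 x) s - min (massBelow μ x) s

/-- The part of the weight of `x` which lies above height `s` when the weights of the elements of
the support are stacked in increasing order. -/
noncomputable def upperPart (s : ℝ) (μ : ChainSimplex P) (x : P) : ℝ :=
  max (massBelow μ x + μ.1 x) s - max (massBelow μ x) s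

lemma lowerPart_add_upperPart (s : ℝ) (μ : ChainSimplex P) (x : P) :
    lowerPart s μ x + upperPart s μ x = μ.1 x := by
  have h₁ := min_add_max (massBelow μ x + μ.1 x) s
  have h₂ := min_add_max (massBelow μ x) s
  unfold lowerPart upperPart
  linarith

lemma lowerPart_nonneg (s : ℝ) (μ : ChainSimplex P) (x : P) : 0 ≤ lowerPart s μ x :=
  sub_nonneg.mpr (min_le_min_right _ (le_add_of_nonneg_right (stdSimplex.zero_le _ x)))

lemma upperPart_nonneg (s : ℝ) (μ : ChainSimplex P) (x : P) : 0 ≤ upperPart s μ x :=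
  sub_nonneg.mpr (max_le_max_right _ (le_add_of_nonneg_right (stdSimplex.zero_le _ x)))

lemma lowerPart_zero (μ : ChainSimplex P) (x : P) : lowerPart 0 μ x = 0 := by
  have := massBelow_nonneg μ x
  have := stdSimplex.zero_le μ.1 x
  rw [lowerPart, min_eq_right (by positivity), min_eq_right (by positivity), sub_self]

lemma upperPart_one (μ : ChainSimplex P) (x : P) : upperPart 1 μ x = 0 := by
  have := massBelow_add_le_one μ x
  have := stdSimplex.zero_le μ.1 x
  rw [upperPart, max_eq_right (by linarith), max_eq_right (by linarith), sub_self]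

lemma ne_zero_of_lowerPart_ne_zero {s : ℝ} {μ : ChainSimplex P} {x : P}
    (h : lowerPart s μ x ≠ 0) : μ.1 x ≠ 0 := fun h' ↦ h (by simp [lowerPart, h'])

lemma ne_zero_of_upperPart_ne_zero {s : ℝ} {μ : ChainSimplex P} {x : P}
    (h : upperPart s μ x ≠ 0) : μ.1 x ≠ 0 := fun h' ↦ h (by simp [upperPart, h'])

lemma le_of_lowerPart_ne_zero {s : ℝ} {μ : ChainSimplex P} {x y : P}
    (hx : lowerPart s μ x ≠ 0) (hy : upperPart s μ y ≠ 0) : x ≤ y := by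
  refine μ.2.le_of_not_gt (ne_zero_of_upperPart_ne_zero hy) (ne_zero_of_lowerPart_ne_zero hx)
    fun hyx ↦ ?_
  have h₁ : massBelow μ x < s := by
    by_contra! h
    have := stdSimplex.zero_le μ.1 x
    exact hx (by rw [lowerPart, min_eq_right h, min_eq_right (by linarith), sub_self])
  have h₂ : s < massBelow μ y + μ.1 y := by
    by_contra! h
    have := stdSimplex.zero_le μ.1 y
    exact hy (by rw [upperPart, max_eq_right h, max_eq_right (by linarith), sub_self])
  exact (massBelow_add_le_massBelow μ hyx).not_gt (h₁.trans h₂)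

/-- The map of order complexes induced by an order-preserving map. -/
noncomputable def map (f : P →o Q) : C(ChainSimplex P, ChainSimplex Q) where
  toFun μ := ⟨stdSimplex.map f μ.1, isChain_support_map f μ.2⟩
  continuous_toFun := ((stdSimplex.continuous_map f).comp continuous_subtype_val).subtype_mk _

/-- The weight obtained by pushing forward the part below height `s` along `f` and the part above
height `s` along `g`. -/
noncomputable def mixWeight (f g : P → Q) (s : ℝ) (μ : ChainSimplex P) : Q → ℝ :=
  FunOnFinite.linearMap ℝ ℝ f (lowerPart s μ) + FunOnFinite.linearMap ℝ ℝ g (upperPart s μ)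

omit [PartialOrder Q] in
lemma mixWeight_mem (f g : P → Q) (s : ℝ) (μ : ChainSimplex P) :
    mixWeight f g s μ ∈ stdSimplex ℝ Q := by
  refine ⟨fun q ↦ add_nonneg (FunOnFinite.linearMap_nonneg (lowerPart_nonneg s μ) q)
    (FunOnFinite.linearMap_nonneg (upperPart_nonneg s μ) q), ?_⟩
  simp only [mixWeight, Pi.add_apply, Finset.sum_add_distrib, FunOnFinite.sum_linearMap]
  simp only [← Finset.sum_add_distrib, lowerPart_add_upperPart, stdSimplex.sum_eq_one]

lemma isChain_support_mixWeight {f g : P →o Q} (hfg : f ≤ g) (s : ℝ) (μ : ChainSimplex P) :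
    IsChain (· ≤ ·) {q | mixWeight f g s μ q ≠ 0} := by
  have key : ∀ q, mixWeight f g s μ q ≠ 0 →
      (∃ x, lowerPart s μ x ≠ 0 ∧ f x = q) ∨ (∃ x, upperPart s μ x ≠ 0 ∧ g x = q) := by
    intro q hq
    by_contra! h
    refine hq ?_
    rw [mixWeight, Pi.add_apply,
      not_ne_iff.mp fun h' ↦ (FunOnFinite.exists_ne_zero_of_linearMap_ne_zero h').elim
        fun x hx ↦ h.1 x hx.1 hx.2,
      not_ne_iff.mp fun h' ↦ (FunOnFinite.exists_ne_zero_of_linearMap_ne_zero h').elim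
        fun x hx ↦ h.2 x hx.1 hx.2,
      add_zero]
  intro q hq r hr _
  rcases key q hq with ⟨x, hx, rfl⟩ | ⟨x, hx, rfl⟩ <;>
    rcases key r hr with ⟨y, hy, rfl⟩ | ⟨y, hy, rfl⟩
  · exact (μ.2.total (ne_zero_of_lowerPart_ne_zero hx) (ne_zero_of_lowerPart_ne_zero hy)).imp
      (fun h ↦ f.monotone h) (fun h ↦ f.monotone h)
  · exact .inl ((f.monotone (le_of_lowerPart_ne_zero hx hy)).trans (hfg y))
  · exact .inr ((f.monotone (le_of_lowerPart_ne_zero hy hx)).trans (hfg x))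
  · exact (μ.2.total (ne_zero_of_upperPart_ne_zero hx) (ne_zero_of_upperPart_ne_zero hy)).imp
      (fun h ↦ g.monotone h) (fun h ↦ g.monotone h)

omit [PartialOrder Q] in
lemma continuous_mixWeight (f g : P → Q) :
    Continuous (fun a : unitInterval × ChainSimplex P ↦ mixWeight f g a.1 a.2) := by
  have hs : Continuous (fun a : unitInterval × ChainSimplex P ↦ (a.1 : ℝ)) :=
    continuous_subtype_val.comp continuous_fst
  have hm (x : P) := (continuous_massBelow x).comp (continuous_snd (X := unitInterval))
  have hμ (x : P) := (continuous_apply_coe x).comp (continuous_snd (X := unitInterval))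
  refine ((FunOnFinite.continuous_linearMap ℝ ℝ f).comp (continuous_pi fun x ↦ ?_)).add
    ((FunOnFinite.continuous_linearMap ℝ ℝ g).comp (continuous_pi fun x ↦ ?_))
  · exact (((hm x).add (hμ x)).min hs).sub ((hm x).min hs)
  · exact (((hm x).add (hμ x)).max hs).sub ((hm x).max hs)

/-- Comparable order-preserving maps induce homotopic maps of order complexes. -/
noncomputable def homotopyOfLE {f g : P →o Q} (hfg : f ≤ g) :
    ContinuousMap.Homotopy (map g) (map f) where
  toFun a := ⟨⟨mixWeight f g a.1 a.2, mixWeight_mem f g _ _⟩,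
    isChain_support_mixWeight hfg _ _⟩
  continuous_toFun := ((continuous_mixWeight f g).subtype_mk _).subtype_mk _
  map_zero_left μ := by
    have h : lowerPart 0 μ = 0 := funext (lowerPart_zero μ)
    have h' : upperPart 0 μ = μ.1 := by
      ext x
      rw [← lowerPart_add_upperPart 0 μ x, lowerPart_zero, zero_add]
    apply Subtype.ext
    ext q
    change mixWeight f g 0 μ q = FunOnFinite.linearMap ℝ ℝ g μ.1 q
    rw [mixWeight, h, h', map_zero, zero_add]
  map_one_left μ := by
    have h : upperPart 1 μ = 0 := funext (upperPart_one μ)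
    have h' : lowerPart 1 μ = μ.1 := by
      ext x
      rw [← lowerPart_add_upperPart 1 μ x, upperPart_one, add_zero]
    apply Subtype.ext
    ext q
    change mixWeight f g 1 μ q = FunOnFinite.linearMap ℝ ℝ f μ.1 q
    rw [mixWeight, h, h', map_zero, add_zero]

lemma map_id : map (OrderHom.id : P →o P) = .id _ :=
  ContinuousMap.ext fun μ ↦ Subtype.ext (stdSimplex.map_id_apply μ.1)

lemma map_comp {R : Type} [PartialOrder R] [Fintype R] (g : Q →o R) (f : P →o Q) :
    map (g.comp f) = (map g).comp (map f) :=
  ContinuousMap.ext fun μ ↦ Subtype.ext (stdSimplex.map_comp_apply f g μ.1).symm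

/-- A Galois connection induces a homotopy equivalence of order complexes. -/
noncomputable def homotopyEquivOfGaloisConnection {f : P →o Q} {g : Q →o P}
    (h : GaloisConnection f g) :
    ContinuousMap.HomotopyEquiv (ChainSimplex P) (ChainSimplex Q) where
  toFun := map f
  invFun := map g
  left_inv := by
    rw [← map_comp, ← map_id]
    exact ⟨homotopyOfLE (f := OrderHom.id) (g := g.comp f) h.le_u_l⟩
  right_inv := by
    rw [← map_comp, ← map_id]
    exact ⟨(homotopyOfLE (f := f.comp g) (g := OrderHom.id) h.l_u_le).symm⟩

end ChainSimplex

/-- A Galois connection between finite posets induces a homotopy equivalence between the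
geometric realizations of their nerves. -/
lemma nonempty_homotopyEquiv_of_galoisConnection {P Q : Type} [PartialOrder P] [PartialOrder Q]
    [Finite P] [Finite Q] {f : P → Q} {g : Q → P} (h : GaloisConnection f g) :
    Nonempty (ContinuousMap.HomotopyEquiv
      (SSet.toTop.obj (nerve P))
      (SSet.toTop.obj (nerve Q))) := by
  have := Fintype.ofFinite P
  have := Fintype.ofFinite Q
  exact ⟨(ChainSimplex.realizationHomeomorph.toHomotopyEquiv.trans
    (ChainSimplex.homotopyEquivOfGaloisConnection (f := ⟨f, h.monotone_l⟩)
      (g := ⟨g, h.monotone_u⟩) h)).trans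
    ChainSimplex.realizationHomeomorph.symm.toHomotopyEquiv⟩

lemma commute_of_mem_closure {G : Type*} [Group G] {s : Set G} (hs : ∀ x ∈ s, ∀ y ∈ s, Commute x y)
    {x y : G} (hx : x ∈ Subgroup.closure s) (hy : y ∈ Subgroup.closure s) : Commute x y :=
  Subgroup.closure_induction₂ (p := fun x y _ _ ↦ Commute x y)
    (fun x y hx hy ↦ hs x hx y hy)
    (fun _ _ ↦ Commute.one_left _) (fun _ _ ↦ Commute.one_right _)
    (fun _ _ _ _ _ _ h h' ↦ h.mul_left h') (fun _ _ _ _ _ _ h h' ↦ h.mul_right h')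
    (fun _ _ _ _ h ↦ h.inv_left) (fun _ _ _ _ h ↦ h.inv_right) hx hy

lemma pow_eq_one_of_mem_closure {G : Type*} [Group G] {s : Set G} {n : ℕ}
    (hs : ∀ x ∈ s, ∀ y ∈ s, Commute x y) (hn : ∀ x ∈ s, x ^ n = 1)
    {x : G} (hx : x ∈ Subgroup.closure s) : x ^ n = 1 := by
  induction hx using Subgroup.closure_induction with
  | mem x hx => exact hn x hx
  | one => exact one_pow n
  | mul x y hx hy h h' => rw [(commute_of_mem_closure hs hx hy).mul_pow, h, h', one_mul]
  | inv x _ h => rw [inv_pow, h, inv_one]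

section

variable {p : ℕ} {G : Type} [Group G]

lemma CommutingPoset.commute (κ : CommutingPoset p G) (hp : p.Prime) {x y : G}
    (hx : x ∈ ⋃ R ∈ κ.1, (R : Set G)) (hy : y ∈ ⋃ R ∈ κ.1, (R : Set G)) : Commute x y := by
  simp only [Set.mem_iUnion, SetLike.mem_coe, exists_prop] at hx hy
  obtain ⟨R, hR, hx⟩ := hx
  obtain ⟨R', hR', hy⟩ := hy
  rcases eq_or_ne R R' with rfl | h
  · have : Fact p.Prime := ⟨hp⟩
    have : IsCyclic R := isCyclic_of_prime_card (κ.2.2.1 R hR)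
    exact congrArg Subtype.val (IsMulCommutative.is_comm.comm (⟨x, hx⟩ : R) ⟨y, hy⟩)
  · exact κ.2.2.2 hR hR' h x hx y hy

/-- The elementary abelian subgroup generated by a set of pairwise commuting subgroups of
order `p`. -/
def CommutingPoset.closure (hp : p.Prime) (κ : CommutingPoset p G) : QuillenPoset p G :=
  ⟨Subgroup.closure (⋃ R ∈ κ.1, (R : Set G)), by
    refine ⟨fun h ↦ ?_, fun x hx y hy ↦
      commute_of_mem_closure (fun x hx y hy ↦ κ.commute hp hx hy) hx hy, fun x hx ↦
      pow_eq_one_of_mem_closure (fun x hx y hy ↦ κ.commute hp hx hy) (fun x hx ↦ ?_) hx⟩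
    · obtain ⟨R, hR⟩ := κ.2.1
      have hR' : R = ⊥ := by
        rw [eq_bot_iff, ← h]
        exact (Set.subset_biUnion_of_mem (u := fun R : Subgroup G ↦ (R : Set G)) hR).trans
          Subgroup.subset_closure
      exact hp.one_lt.ne (by rw [← κ.2.2.1 R hR, hR', Subgroup.card_bot])
    · simp only [Set.mem_iUnion, SetLike.mem_coe, exists_prop] at hx
      obtain ⟨R, hR, hx⟩ := hx
      have := pow_card_eq_one' (x := (⟨x, hx⟩ : R))
      rw [κ.2.2.1 R hR] at this
      exact congrArg Subtype.val this⟩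

/-- The set of subgroups of order `p` of an elementary abelian subgroup. -/
def QuillenPoset.subgroupsOfPrimeOrder (hp : p.Prime) (Q : QuillenPoset p G) :
    CommutingPoset p G :=
  ⟨{R | R ≤ Q.1 ∧ Nat.card R = p}, by
    refine ⟨?_, fun R hR ↦ hR.2, fun R hR R' hR' _ r hr r' hr' ↦
      Q.2.2.1 r (hR.1 hr) r' (hR'.1 hr')⟩
    obtain ⟨x, hx, hx'⟩ := Q.1.bot_or_exists_ne_one.resolve_left Q.2.1
    exact ⟨Subgroup.zpowers x, Subgroup.zpowers_le.mpr hx, by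
      rw [Nat.card_zpowers, (orderOf_eq_prime_iff (hp := ⟨hp⟩)).mpr ⟨Q.2.2.2 x hx, hx'⟩]⟩⟩

lemma CommutingPoset.galoisConnection_closure (hp : p.Prime) :
    GaloisConnection (CommutingPoset.closure (G := G) hp)
      (QuillenPoset.subgroupsOfPrimeOrder hp) := by
  intro κ Q
  change Subgroup.closure _ ≤ Q.1 ↔ κ.1 ⊆ _
  rw [Subgroup.closure_le, Set.iUnion₂_subset_iff]
  exact ⟨fun h R hR ↦ ⟨h R hR, κ.2.2.1 R hR⟩, fun h R hR ↦ (h hR).1⟩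

end

/-- The geometric realizations of the nerves of the posets `A_p(G)` and
`K_p(G)` (each regarded as a category) are homotopy equivalent topological spaces. -/
theorem quillenPoset_homotopyEquiv_commutingPoset
    (p : ℕ) (hp : p.Prime) (G : Type) [Group G] [Finite G] :
    Nonempty (ContinuousMap.HomotopyEquiv
      (SSet.toTop.obj (nerve (QuillenPoset p G)))
      (SSet.toTop.obj (nerve (CommutingPoset p G)))) := by
  have : Finite (QuillenPoset p G) := inferInstanceAs (Finite (Subtype _))
  have : Finite (CommutingPoset p G) := inferInstanceAs (Finite (Subtype _))
  obtain ⟨e⟩ := nonempty_homotopyEquiv_of_galoisConnection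
    (CommutingPoset.galoisConnection_closure (G := G) hp)
  exact ⟨e.symm⟩
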